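/- Let p be a prime, n ≥ 2 an integer, r ∈ ℤ, t ∈ ℚ_p with t ≠ 1, ξ ∈ ℚ_p^{n−1} a column vector, λ ∈ ℚ_p^×, and y ∈ GL_n(ℚ_p). If λ·M_B(ξ,t,r)·ι(y) ∈ GL_{n+1}(ℤ_p), then λ ∈ ℤ_p^×, ξ ∈ ℤ_p^{n−1} (i.e. v_p(ξ_j) ≥ 0 for every j), and v_p(t−1) ≤ r. -/

import Mathlib

open Matrix

/-- Membership in `GL(ℤ_p)`: all entries are `p`-adic integers and the determinant is a
`p`-adic unit. -/
def IsGLZ (p : ℕ) [Fact p.Prime] {ι : Type*} [Fintype ι] [DecidableEq ι]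
    (g : Matrix ι ι ℚ_[p]) : Prop :=
  (∀ i j, ‖g i j‖ ≤ 1) ∧ ‖g.det‖ = 1

/-- The matrix `X(ξ,t) ∈ GL_{n+1}(ℚ_p)` (here `n = m+2`, and the index set of size `n+1`
is `(Fin (m+1) ⊕ Unit) ⊕ Unit`, with `Fin (m+1)` the first `n-1` coordinates, the inner
`Unit` the `n`-th coordinate and the outer `Unit` the `(n+1)`-st coordinate): the
upper-left `(n-1)×(n-1)` block is the identity, the last column is
`((1-t)ξ₁,…,(1-t)ξ_{n-1}, t, 1)ᵀ`, the entries in positions `(n,n)` and `(n+1,n)` equal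
`1`, and all remaining entries are `0`. -/
noncomputable def Xmat (p : ℕ) [Fact p.Prime] {m : ℕ} (ξ : Fin (m+1) → ℚ_[p]) (t : ℚ_[p]) :
    Matrix ((Fin (m+1) ⊕ Unit) ⊕ Unit) ((Fin (m+1) ⊕ Unit) ⊕ Unit) ℚ_[p] :=
  Matrix.of (fun i j =>
    match i, j with
    | Sum.inl (Sum.inl a), Sum.inl (Sum.inl b) => if a = b then 1 else 0
    | Sum.inl (Sum.inl a), Sum.inr _ => (1 - t) * ξ a
    | Sum.inl (Sum.inr _), Sum.inl (Sum.inr _) => 1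
    | Sum.inl (Sum.inr _), Sum.inr _ => t
    | Sum.inr _, Sum.inl (Sum.inr _) => 1
    | Sum.inr _, Sum.inr _ => 1
    | _, _ => 0)

/-- `ι(z·I_n) ∈ GL_{n+1}(ℚ_p)`, the block-diagonal matrix `diag(z,…,z,1)`. -/
noncomputable def iotaScalar (p : ℕ) [Fact p.Prime] {ι : Type*} [DecidableEq ι] (z : ℚ_[p]) :
    Matrix (ι ⊕ Unit) (ι ⊕ Unit) ℚ_[p] :=
  Matrix.diagonal (Sum.elim (fun _ : ι => z) (fun _ : Unit => 1))

/-- The block-diagonal embedding `ι(y) = diag(y, 1)`. -/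
noncomputable def iotaMat (p : ℕ) [Fact p.Prime] {ι : Type*} (y : Matrix ι ι ℚ_[p]) :
    Matrix (ι ⊕ Unit) (ι ⊕ Unit) ℚ_[p] :=
  Matrix.fromBlocks y 0 0 1

/-- The matrix `M_B(ξ,t,r)`: upper-left `n×n` block
`diag(p^r(1-t)⁻¹,…,p^r(1-t)⁻¹, p^{2r}(1-t)⁻¹)`, last column
`(ξ₁,…,ξ_{n-1}, p^r(1-t)⁻¹, 1)ᵀ`, last row `(0,…,0,1)`. -/
noncomputable def MBmat (p : ℕ) [Fact p.Prime] {m : ℕ} (ξ : Fin (m+1) → ℚ_[p]) (t : ℚ_[p]) (r : ℤ) :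
    Matrix ((Fin (m+1) ⊕ Unit) ⊕ Unit) ((Fin (m+1) ⊕ Unit) ⊕ Unit) ℚ_[p] :=
  Matrix.of (fun i j =>
    match i, j with
    | Sum.inl (Sum.inl a), Sum.inl (Sum.inl b) =>
        if a = b then (p : ℚ_[p]) ^ r * (1 - t)⁻¹ else 0
    | Sum.inl (Sum.inr _), Sum.inl (Sum.inr _) => (p : ℚ_[p]) ^ (2 * r) * (1 - t)⁻¹
    | Sum.inl (Sum.inl a), Sum.inr _ => ξ a
    | Sum.inl (Sum.inr _), Sum.inr _ => (p : ℚ_[p]) ^ r * (1 - t)⁻¹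
    | Sum.inr _, Sum.inr _ => 1
    | _, _ => 0)

theorem Padic.norm_det_le_one {p : ℕ} [Fact p.Prime] {ι : Type*} [Fintype ι] [DecidableEq ι]
    (A : Matrix ι ι ℚ_[p]) (hA : ∀ i j, ‖A i j‖ ≤ 1) : ‖A.det‖ ≤ 1 := by
  let B : Matrix ι ι ℤ_[p] := Matrix.of fun i j => ⟨A i j, hA i j⟩
  have hB : PadicInt.Coe.ringHom.mapMatrix B = A := rfl
  rw [← hB, ← RingHom.map_det]
  exact B.det.2

/-- forced integrality, case (B) of the proof of Lemma 9.4: if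
`λ·M_B(ξ,t,r)·ι(y) ∈ GL_{n+1}(ℤ_p)` then `λ ∈ ℤ_p^×`, `ξ ∈ ℤ_p^{n-1}` and
`v_p(t-1) ≤ r` (stated as `p^{-r} ≤ ‖t-1‖`). -/
theorem stmt8 (p : ℕ) [Fact p.Prime] (m : ℕ) (r : ℤ) (t : ℚ_[p]) (ht : t ≠ 1)
    (ξ : Fin (m+1) → ℚ_[p]) (lam : ℚ_[p]) (hlam : lam ≠ 0)
    (y : Matrix (Fin (m+1) ⊕ Unit) (Fin (m+1) ⊕ Unit) ℚ_[p]) (hy : IsUnit y.det)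
    (h : IsGLZ p (lam • (MBmat p ξ t r * iotaMat p y))) :
    ‖lam‖ = 1 ∧ (∀ j, ‖ξ j‖ ≤ 1) ∧ (p : ℝ) ^ (-r) ≤ ‖t - 1‖ := by
  set M := lam • (MBmat p ξ t r * iotaMat p y) with hM
  have hcol (i : (Fin (m+1) ⊕ Unit) ⊕ Unit) :
      M i (Sum.inr ()) = lam * MBmat p ξ t r i (Sum.inr ()) := by
    simp [hM, Matrix.mul_apply, iotaMat]
  have hrow : M.toBlocks₂₁ = 0 := by
    ext i j
    simp [hM, Matrix.toBlocks₂₁, Matrix.mul_apply, iotaMat, MBmat]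
  have hcorner : M (Sum.inr ()) (Sum.inr ()) = lam := by
    simp [hcol, MBmat]
  have hdet : M.det = M.toBlocks₁₁.det * lam := by
    rw [← Matrix.fromBlocks_toBlocks M, hrow, Matrix.det_fromBlocks_zero₂₁,
      Matrix.toBlocks_fromBlocks₁₁, Matrix.det_unique (n := Unit)]
    exact congrArg _ hcorner
  obtain ⟨hint, hunit⟩ := h
  have hlam_le : ‖lam‖ ≤ 1 := hcorner ▸ hint (Sum.inr ()) (Sum.inr ())
  have hlam_norm : ‖lam‖ = 1 := by
    refine le_antisymm hlam_le ?_
    rw [← hunit, hdet, norm_mul]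
    exact mul_le_of_le_one_left (norm_nonneg _)
      (Padic.norm_det_le_one _ fun i j => hint (Sum.inl i) (Sum.inl j))
  have hcol_le (i : (Fin (m+1) ⊕ Unit) ⊕ Unit) : ‖MBmat p ξ t r i (Sum.inr ())‖ ≤ 1 := by
    simpa [hcol, hlam_norm] using hint i (Sum.inr ())
  refine ⟨hlam_norm, fun j => hcol_le (Sum.inl (Sum.inl j)), ?_⟩
  have hlast : ‖(p : ℚ_[p]) ^ r * (1 - t)⁻¹‖ ≤ 1 := hcol_le (Sum.inl (Sum.inr ()))
  have hpos : 0 < ‖1 - t‖ := norm_pos_iff.mpr (sub_ne_zero.mpr ht.symm)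
  rw [norm_mul, norm_inv, Padic.norm_p_zpow, ← div_eq_mul_inv, div_le_one hpos] at hlast
  rwa [norm_sub_rev]
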